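/- arXiv:1704.04778 — 2 statements merged into one kernel-verified Lean document; each statement's English description precedes it below -/
import Mathlib

section
/- Let 𝓛 ⊂ ℝ^d × ℝ^m be a full-rank lattice such that the projection p₁ onto ℝ^d is injective on 𝓛 and p₂(𝓛) is dense in ℝ^m, and let h : ℝ^m → ℂ be continuous with compact support such that 𝓕h ∈ L¹(ℝ^m), where 𝓕h(y) = ∫_{ℝ^m} h(t) e^{−2πi⟨y,t⟩} dt. Then the dual formal sum ∑_{(χ,χ⋆) ∈ 𝓛⁰} 𝓕h(χ⋆) δ_χ is weakly admissible: for every continuous compactly supported f : ℝ^d → ℂ, the family (‖𝓕h(χ⋆)‖ · ‖𝓕⁻¹f(χ)‖²) indexed by (χ,χ⋆) ∈ 𝓛⁰ is summable. -/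
open MeasureTheory Metric Filter
open scoped Pointwise FourierTransform RealInnerProductSpace ENNReal Topology

noncomputable section

/-- Self-adjointness of the Fourier transform for integrable functions. -/
lemma aux_selfadj {n : ℕ} (f g : EuclideanSpace ℝ (Fin n) → ℂ) (hf : Integrable f)
    (hg : Integrable g) : ∫ x, 𝓕 f x * g x = ∫ x, f x * 𝓕 g x := by
  have := VectorFourier.integral_fourierIntegral_smul_eq_flip (μ := volume) (ν := volume)
    (L := innerₗ (EuclideanSpace ℝ (Fin n))) Real.continuous_fourierChar continuous_inner hf hg
  rw [flip_innerₗ] at this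
  simp only [smul_eq_mul] at this
  exact this

lemma aux_cont {n : ℕ} (f : EuclideanSpace ℝ (Fin n) → ℂ) (hf : Continuous f)
    (hfc : HasCompactSupport f) : Continuous (𝓕 f) :=
  VectorFourier.fourierIntegral_continuous Real.continuous_fourierChar
      continuous_inner (hf.integrable_of_hasCompactSupport (μ := volume) hfc)

/-- The Fourier transform of a compactly supported continuous function is in `L²`. -/
lemma aux_L2 {n : ℕ} (f : EuclideanSpace ℝ (Fin n) → ℂ) (hf : Continuous f)
    (hfc : HasCompactSupport f) : MemLp (𝓕 f) 2 volume := by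
  have h2 : MemLp f 2 volume := hf.memLp_of_hasCompactSupport (μ := volume) hfc
  have h1 : Integrable f := hf.integrable_of_hasCompactSupport (μ := volume) hfc
  set F : Lp ℂ 2 (volume : Measure (EuclideanSpace ℝ (Fin n))) := 𝓕 (h2.toLp f)
  have hcont : Continuous (𝓕 f) := aux_cont f hf hfc
  have key : ∀ᵐ x, F x = 𝓕 f x := by
    apply ae_eq_of_integral_contDiff_smul_eq
    · exact (Lp.memLp F).locallyIntegrable (by norm_num)
    · exact hcont.locallyIntegrable
    · intro g hg hgc
      have hgc' : HasCompactSupport (Complex.ofRealCLM ∘ g) := hgc.comp_left rfl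
      let G : SchwartzMap (EuclideanSpace ℝ (Fin n)) ℂ :=
        hgc'.toSchwartzMap (Complex.ofRealCLM.contDiff.comp hg)
      have e := congrArg (fun T => T G) (Lp.fourier_toTemperedDistribution_eq (h2.toLp f))
      simp only [TemperedDistribution.fourier_apply, Lp.toTemperedDistribution_apply] at e
      have hG : ∀ x, G x = (g x : ℂ) := fun x => rfl
      have e2 : ∫ x, (𝓕 G) x • (h2.toLp f) x = ∫ x, 𝓕 (G : _ → ℂ) x * f x := by
        apply integral_congr_ae
        filter_upwards [h2.coeFn_toLp] with x hx
        rw [hx, SchwartzMap.fourier_coe, smul_eq_mul]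
      rw [e2, aux_selfadj _ _ G.integrable h1] at e
      simp only [hG] at e
      simp only [Complex.real_smul]
      simpa using e.symm
  exact (memLp_congr_ae key).1 (Lp.memLp F)

/-- Reproducing formula. -/
lemma aux_repr {n : ℕ} (f : EuclideanSpace ℝ (Fin n) → ℂ) (hf : Continuous f)
    (hfc : HasCompactSupport f) : ∃ k : SchwartzMap (EuclideanSpace ℝ (Fin n)) ℂ,
      ∀ x, 𝓕 f x = ∫ s, 𝓕 f s * k (s - x) := by
  have h1 : Integrable f := hf.integrable_of_hasCompactSupport (μ := volume) hfc
  obtain ⟨R, hR⟩ := hfc.isCompact.isBounded.subset_closedBall (0 : EuclideanSpace ℝ (Fin n))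
  let b : ContDiffBump (0 : EuclideanSpace ℝ (Fin n)) :=
    ⟨max R 1, max R 1 + 1, by positivity, by linarith⟩
  have hbc : HasCompactSupport (Complex.ofRealCLM ∘ b) := b.hasCompactSupport.comp_left rfl
  let φ : SchwartzMap (EuclideanSpace ℝ (Fin n)) ℂ :=
    hbc.toSchwartzMap (Complex.ofRealCLM.contDiff.comp b.contDiff)
  have hφ : ∀ x, f x * φ x = f x := by
    intro x
    by_cases hx : x ∈ tsupport f
    · have : b x = 1 := b.one_of_mem_closedBall
        (closedBall_subset_closedBall (le_max_left _ _) (hR hx))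
      have : φ x = 1 := by simp [φ, this]
      rw [this, mul_one]
    · rw [image_eq_zero_of_notMem_tsupport hx, zero_mul]
  refine ⟨𝓕⁻ φ, fun x => ?_⟩
  have hk : 𝓕 ((𝓕⁻ φ : SchwartzMap (EuclideanSpace ℝ (Fin n)) ℂ) : _ → ℂ) = φ := by
    rw [← SchwartzMap.fourier_coe, FourierTransform.fourier_fourierInv_eq]
  let g : EuclideanSpace ℝ (Fin n) → ℂ := fun t => Real.fourierChar (-⟪t, x⟫) • f t
  have hg : Integrable g := by
    have : Continuous g := by
      simp only [g]
      have := Real.continuous_fourierChar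
      fun_prop
    apply this.integrable_of_hasCompactSupport
    exact hfc.smul_left
  have hgF : ∀ ξ, 𝓕 g ξ = 𝓕 f (ξ + x) := by
    intro ξ
    rw [Real.fourier_eq, Real.fourier_eq]
    congr 1; ext t
    simp only [g]
    rw [smul_smul, ← AddChar.map_add_eq_mul, inner_add_right, neg_add]
  have := aux_selfadj g (𝓕⁻ φ : SchwartzMap (EuclideanSpace ℝ (Fin n)) ℂ) hg
    (SchwartzMap.integrable _)
  rw [hk] at this
  have e1 : 𝓕 f x = ∫ t, g t * φ t := by
    rw [Real.fourier_eq]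
    congr 1; ext t
    simp only [g]
    rw [smul_mul_assoc, hφ]
  rw [e1, ← this, ← integral_sub_right_eq_self _ x]
  simp [hgF]

/-- decay weight -/
def auxW (n : ℕ) (x : EuclideanSpace ℝ (Fin n)) : ℝ≥0∞ :=
  ENNReal.ofReal ((1 + ‖x‖) ^ (-((n + 1 : ℕ) : ℝ)))

lemma auxW_meas (n : ℕ) : Measurable (auxW n) := by
  unfold auxW; fun_prop

lemma auxW_int (n : ℕ) : ∫⁻ x, auxW n x ≠ ∞ := by
  have : Integrable (fun x : EuclideanSpace ℝ (Fin n) =>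
      (1 + ‖x‖) ^ (-((n + 1 : ℕ) : ℝ))) volume :=
    integrable_one_add_norm (by simp)
  exact this.lintegral_lt_top.ne

lemma auxW_le (n : ℕ) (x y : EuclideanSpace ℝ (Fin n)) (h : ‖x - y‖ ≤ 1) :
    auxW n x ≤ 2 ^ (n + 1) * auxW n y := by
  unfold auxW
  have e2 : (2 : ℝ≥0∞) ^ (n + 1) = ENNReal.ofReal (2 ^ (n + 1)) := by
    rw [ENNReal.ofReal_pow (by norm_num)]; simp
  rw [e2, ← ENNReal.ofReal_mul (by positivity)]
  apply ENNReal.ofReal_le_ofReal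
  rw [Real.rpow_neg (by positivity), Real.rpow_neg (by positivity), Real.rpow_natCast,
    Real.rpow_natCast, ← div_eq_mul_inv, inv_eq_one_div, div_le_div_iff₀ (by positivity)
    (by positivity), one_mul, ← mul_pow]
  have : ‖y‖ ≤ ‖x‖ + ‖x - y‖ := by
    have := norm_sub_le x (x - y); simpa using this
  gcongr
  linarith [norm_nonneg x]

lemma auxW_schwartz {n : ℕ} (k : SchwartzMap (EuclideanSpace ℝ (Fin n)) ℂ) :
    ∃ C : ℝ≥0∞, C ≠ ∞ ∧ ∀ x, ‖k x‖ₑ ≤ C * auxW n x := by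
  let S : ℝ := 2 ^ (n + 1) *
    (Finset.Iic (n + 1, 0)).sup (fun m => SchwartzMap.seminorm ℝ m.1 m.2) k
  refine ⟨ENNReal.ofReal S, ENNReal.ofReal_ne_top, fun x => ?_⟩
  have h := SchwartzMap.one_add_le_sup_seminorm_apply (𝕜 := ℝ) (m := (n + 1, 0)) (k := n + 1)
    (n := 0) le_rfl le_rfl k x
  rw [norm_iteratedFDeriv_zero] at h
  have hS : 0 ≤ S := le_trans (by positivity) h
  unfold auxW
  rw [← ENNReal.ofReal_mul hS, ← ofReal_norm]
  apply ENNReal.ofReal_le_ofReal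
  rw [Real.rpow_neg (by positivity), Real.rpow_natCast, ← div_eq_mul_inv,
    le_div_iff₀ (by positivity), mul_comm]
  exact h

/-- Local domination of a function controlled by its own average. -/
lemma aux_dom {n : ℕ} (Φ : EuclideanSpace ℝ (Fin n) → ℝ≥0∞) (hΦ : Measurable Φ)
    (hfin : ∫⁻ x, Φ x ≠ ∞) (C : ℝ≥0∞) (hC : C ≠ ∞)
    (hle : ∀ x, Φ x ≤ C * ∫⁻ s, auxW n (s - x) * Φ s) :
    ∃ A : EuclideanSpace ℝ (Fin n) → ℝ≥0∞, Measurable A ∧ ∫⁻ x, A x ≠ ∞ ∧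
      ∀ x y, ‖x - y‖ ≤ 1 → Φ x ≤ A y := by
  have hW := auxW_meas n
  have hm : Measurable (Function.uncurry fun y s : EuclideanSpace ℝ (Fin n) =>
      auxW n (s - y) * Φ s) := by
    unfold Function.uncurry
    fun_prop
  refine ⟨fun y => (C * 2 ^ (n + 1)) * ∫⁻ s, auxW n (s - y) * Φ s, ?_, ?_, ?_⟩
  · exact (Measurable.lintegral_prod_right hm).const_mul _
  · rw [lintegral_const_mul _ (Measurable.lintegral_prod_right hm),
      lintegral_lintegral_swap hm.aemeasurable]
    have : ∀ s, ∫⁻ y, auxW n (s - y) * Φ s = (∫⁻ y, auxW n y) * Φ s := by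
      intro s
      rw [lintegral_mul_const _ (by fun_prop), lintegral_sub_left_eq_self (auxW n) s]
    simp_rw [this]
    rw [lintegral_const_mul _ hΦ]
    exact ENNReal.mul_ne_top (ENNReal.mul_ne_top hC (by finiteness))
      (ENNReal.mul_ne_top (auxW_int n) hfin)
  · intro x y hxy
    refine (hle x).trans ?_
    simp only [mul_assoc]
    gcongr
    rw [← lintegral_const_mul _ (by fun_prop)]
    apply lintegral_mono
    intro s
    simp only
    rw [← mul_assoc]
    gcongr
    apply auxW_le
    rw [sub_sub_sub_cancel_left, norm_sub_rev]
    exact hxy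

lemma aux_bound {n : ℕ} (f : EuclideanSpace ℝ (Fin n) → ℂ) (hf : Continuous f)
    (hfc : HasCompactSupport f) : ∃ C : ℝ≥0∞, C ≠ ∞ ∧
      ∀ x, ‖𝓕 f x‖ₑ ≤ C * ∫⁻ s, auxW n (s - x) * ‖𝓕 f s‖ₑ := by
  obtain ⟨k, hk⟩ := aux_repr f hf hfc
  obtain ⟨C, hC, hkC⟩ := auxW_schwartz k
  have hW := auxW_meas n
  have hc := aux_cont f hf hfc
  refine ⟨C, hC, fun x => ?_⟩
  rw [← lintegral_const_mul _ (by fun_prop)]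
  conv_lhs => rw [hk x]
  refine (enorm_integral_le_lintegral_enorm _).trans ?_
  gcongr with s
  rw [enorm_mul, mul_comm, ← mul_assoc]
  gcongr
  exact hkC _

lemma aux_bound_sq {n : ℕ} (f : EuclideanSpace ℝ (Fin n) → ℂ) (hf : Continuous f)
    (hfc : HasCompactSupport f) : ∃ C : ℝ≥0∞, C ≠ ∞ ∧
      ∀ x, ‖𝓕 f x‖ₑ ^ 2 ≤ C * ∫⁻ s, auxW n (s - x) * ‖𝓕 f s‖ₑ ^ 2 := by
  obtain ⟨C, hC, h⟩ := aux_bound f hf hfc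
  have hW := auxW_meas n
  have hc := aux_cont f hf hfc
  refine ⟨C ^ 2 * ∫⁻ s, auxW n s, ENNReal.mul_ne_top (by finiteness) (auxW_int n),
    fun x => ?_⟩
  have hx := h x
  have hs : ∀ a : ℝ≥0∞, (a ^ (1 / 2 : ℝ)) ^ 2 = a := by
    intro a
    rw [← ENNReal.rpow_natCast, ← ENNReal.rpow_mul]; norm_num
  have cs := ENNReal.lintegral_mul_le_Lp_mul_Lq (μ := volume) (p := 2) (q := 2)
    (f := fun s => auxW n (s - x) ^ (1 / 2 : ℝ))
    (g := fun s => auxW n (s - x) ^ (1 / 2 : ℝ) * ‖𝓕 f s‖ₑ) Real.HolderConjugate.two_two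
    (by fun_prop) (by fun_prop)
  simp only [Pi.mul_apply] at cs
  have e : ∫⁻ s, auxW n (s - x) * ‖𝓕 f s‖ₑ = ∫⁻ s, auxW n (s - x) ^ (1 / 2 : ℝ) *
      (auxW n (s - x) ^ (1 / 2 : ℝ) * ‖𝓕 f s‖ₑ) := by
    congr 1; ext s
    rw [← mul_assoc, ← sq, hs]
  rw [← e] at cs
  have cs2 := pow_le_pow_left₀ zero_le cs 2
  simp only [ENNReal.rpow_ofNat, mul_pow, hs] at cs2
  rw [lintegral_sub_right_eq_self (auxW n) x] at cs2
  calc ‖𝓕 f x‖ₑ ^ 2 ≤ (C * ∫⁻ s, auxW n (s - x) * ‖𝓕 f s‖ₑ) ^ 2 := by gcongr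
    _ ≤ _ := by
      rw [mul_pow, mul_assoc]
      gcongr

/-- The dual lattice is uniformly discrete. -/
lemma aux_sep {d m : ℕ}
    (L : Submodule ℤ (EuclideanSpace ℝ (Fin d) × EuclideanSpace ℝ (Fin m)))
    [DiscreteTopology L] [IsZLattice ℝ L] :
    ∃ r : ℝ, 0 < r ∧ ∀ q : EuclideanSpace ℝ (Fin d) × EuclideanSpace ℝ (Fin m),
      (∀ p ∈ L, ∃ n : ℤ, ⟪q.1, p.1⟫ + ⟪q.2, p.2⟫ = (n : ℝ)) → ‖q‖ < r → q = 0 := by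
  have hfg : L.FG := ZLattice.FG ℝ L
  obtain ⟨S, hS⟩ := hfg
  obtain ⟨R, hR⟩ := (S.finite_toSet.image norm).bddAbove
  have hRS : ∀ p ∈ S, ‖p‖ ≤ R := fun p hp => hR ⟨p, hp, rfl⟩
  refine ⟨1 / (2 * (|R| + 1)), by positivity, fun q hq hqr => ?_⟩
  let ℓ : (EuclideanSpace ℝ (Fin d) × EuclideanSpace ℝ (Fin m)) →ₗ[ℝ] ℝ :=
    (innerₗ _ q.1).comp (LinearMap.fst ℝ _ _) + (innerₗ _ q.2).comp (LinearMap.snd ℝ _ _)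
  have hℓ : ∀ p, ℓ p = ⟪q.1, p.1⟫ + ⟪q.2, p.2⟫ := fun p => rfl
  have hSℓ : ∀ p ∈ S, ℓ p = 0 := by
    intro p hp
    obtain ⟨n, hn⟩ := hq p (hS ▸ Submodule.subset_span hp)
    have b1 : |⟪q.1, p.1⟫| ≤ ‖q‖ * ‖p‖ := (abs_real_inner_le_norm _ _).trans
      (mul_le_mul (norm_fst_le q) (norm_fst_le p) (norm_nonneg _) (norm_nonneg _))
    have b2 : |⟪q.2, p.2⟫| ≤ ‖q‖ * ‖p‖ := (abs_real_inner_le_norm _ _).trans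
      (mul_le_mul (norm_snd_le q) (norm_snd_le p) (norm_nonneg _) (norm_nonneg _))
    have b3 : ‖q‖ * ‖p‖ ≤ ‖q‖ * (|R| + 1) := by
      gcongr
      linarith [hRS p hp, le_abs_self R]
    have b4 : ‖q‖ * (2 * (|R| + 1)) < 1 := (lt_div_iff₀ (by positivity)).1 hqr
    have b5 : |(n : ℝ)| < 1 := by
      rw [← hn]
      refine (abs_add_le _ _).trans_lt ?_
      linarith
    have : n = 0 := by
      have : |n| < 1 := by exact_mod_cast b5
      exact Int.abs_lt_one_iff.1 this
    rw [hℓ, hn, this, Int.cast_zero]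
  have hLℓ : ∀ p ∈ L, ℓ p = 0 := by
    intro p hp
    rw [← hS] at hp
    induction hp using Submodule.span_induction with
    | mem x hx => exact hSℓ x hx
    | zero => simp
    | add x y _ _ hx hy => rw [map_add, hx, hy, add_zero]
    | smul a x _ hx => rw [map_zsmul, hx, smul_zero]
  have htop : (⊤ : Submodule ℝ (EuclideanSpace ℝ (Fin d) × EuclideanSpace ℝ (Fin m)))
      ≤ LinearMap.ker ℓ := by
    rw [← IsZLattice.span_top (K := ℝ) (L := L), Submodule.span_le]
    intro p hp
    exact hLℓ p hp
  have h0 : ℓ q = 0 := htop (Submodule.mem_top (x := q))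
  rw [hℓ, real_inner_self_eq_norm_sq, real_inner_self_eq_norm_sq] at h0
  have n1 : ‖q.1‖ ^ 2 = 0 := by nlinarith [sq_nonneg ‖q.1‖, sq_nonneg ‖q.2‖]
  have n2 : ‖q.2‖ ^ 2 = 0 := by nlinarith [sq_nonneg ‖q.1‖, sq_nonneg ‖q.2‖]
  refine Prod.ext ?_ ?_
  · simpa using n1
  · simpa using n2

lemma aux_fourierInv {n : ℕ} (f : EuclideanSpace ℝ (Fin n) → ℂ) (x : EuclideanSpace ℝ (Fin n)) :
    𝓕⁻ f x = 𝓕 (fun t => f (-t)) x := by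
  rw [Real.fourierInv_eq_fourier_comp_neg]

/-- For a Euclidean cut-and-project scheme given by a full-rank lattice
`L ⊂ ℝ^d × ℝ^m` and `h : ℝ^m → ℂ` continuous with compact support such that `𝓕h ∈ L¹(ℝ^m)`,
the dual formal sum `∑_{(χ,χ⋆) ∈ L⁰} 𝓕h(χ⋆) δ_χ` is weakly admissible: for every continuous
compactly supported `f : ℝ^d → ℂ`, the family `(‖𝓕h(χ⋆)‖·‖𝓕⁻¹f(χ)‖²)_{(χ,χ⋆) ∈ L⁰}` is
summable. -/
theorem fourierTransformable_sap_stmt12 {d m : ℕ}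
    (L : Submodule ℤ (EuclideanSpace ℝ (Fin d) × EuclideanSpace ℝ (Fin m)))
    [DiscreteTopology L] [IsZLattice ℝ L]
    (hinj : ∀ p q : L, (p : EuclideanSpace ℝ (Fin d) × EuclideanSpace ℝ (Fin m)).1 =
      (q : EuclideanSpace ℝ (Fin d) × EuclideanSpace ℝ (Fin m)).1 → p = q)
    (hdense : Dense (Prod.snd '' (L : Set (EuclideanSpace ℝ (Fin d) × EuclideanSpace ℝ (Fin m)))))
    (h : EuclideanSpace ℝ (Fin m) → ℂ) (hh : Continuous h) (hhc : HasCompactSupport h)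
    (hL1 : Integrable (𝓕 h) volume) :
    ∀ f : EuclideanSpace ℝ (Fin d) → ℂ, Continuous f → HasCompactSupport f →
      Summable fun q : {q : EuclideanSpace ℝ (Fin d) × EuclideanSpace ℝ (Fin m) //
          ∀ p ∈ L, ∃ n : ℤ,
            ⟪q.1, (p : EuclideanSpace ℝ (Fin d) × EuclideanSpace ℝ (Fin m)).1⟫
              + ⟪q.2, (p : EuclideanSpace ℝ (Fin d) × EuclideanSpace ℝ (Fin m)).2⟫ = (n : ℝ)} =>
        ‖𝓕 h (q : EuclideanSpace ℝ (Fin d) × EuclideanSpace ℝ (Fin m)).2‖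
          * ‖𝓕⁻ f (q : EuclideanSpace ℝ (Fin d) × EuclideanSpace ℝ (Fin m)).1‖ ^ 2 := by
  intro f hf hfc
  obtain ⟨r, hr, hsep⟩ := aux_sep L
  -- domination in each factor
  have hcont := aux_cont h hh hhc
  obtain ⟨C₂, hC₂, hle₂⟩ := aux_bound h hh hhc
  obtain ⟨A₂, hA₂m, hA₂i, hA₂⟩ := aux_dom (fun y => ‖𝓕 h y‖ₑ) (by fun_prop)
    (by exact hL1.2.ne) C₂ hC₂ hle₂
  have hf' : Continuous fun t => f (-t) := by fun_prop
  have hfc' : HasCompactSupport fun t => f (-t) := hfc.comp_homeomorph (Homeomorph.neg _)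
  have hcont' := aux_cont _ hf' hfc'
  obtain ⟨C₁, hC₁, hle₁⟩ := aux_bound_sq _ hf' hfc'
  have hint : ∫⁻ x, ‖𝓕 (fun t => f (-t)) x‖ₑ ^ 2 ≠ ∞ := by
    have := (aux_L2 _ hf' hfc').eLpNorm_lt_top
    have := (eLpNorm_lt_top_iff_lintegral_rpow_enorm_lt_top (by norm_num) (by norm_num)).1 this
    simpa using this.ne
  obtain ⟨A₁, hA₁m, hA₁i, hA₁⟩ := aux_dom (fun x => ‖𝓕 (fun t => f (-t)) x‖ₑ ^ 2)
    (by fun_prop) hint C₁ hC₁ hle₁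
  simp_rw [aux_fourierInv f]
  set ρ : ℝ := min (r / 2) 1 with hρ
  have hρ0 : 0 < ρ := by positivity
  set B : ℝ≥0∞ := volume (ball (0 : EuclideanSpace ℝ (Fin d) × EuclideanSpace ℝ (Fin m)) ρ)
    with hB
  have hB0 : B ≠ 0 := (measure_ball_pos volume _ hρ0).ne'
  have hBt : B ≠ ∞ := measure_ball_lt_top.ne
  set T : ℝ≥0∞ := (∫⁻ x, A₁ x) * ∫⁻ y, A₂ y with hT
  have hTt : T ≠ ∞ := ENNReal.mul_ne_top hA₁i hA₂i
  have hTeq : ∫⁻ z : EuclideanSpace ℝ (Fin d) × EuclideanSpace ℝ (Fin m), A₁ z.1 * A₂ z.2 = T := by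
    rw [Measure.volume_eq_prod]
    exact lintegral_prod_mul hA₁m.aemeasurable hA₂m.aemeasurable
  apply summable_of_sum_le (c := (T / B).toReal)
  · intro q; positivity
  intro s
  have hterm : ∀ q : EuclideanSpace ℝ (Fin d) × EuclideanSpace ℝ (Fin m),
      ‖𝓕 h q.2‖ * ‖𝓕 (fun t => f (-t)) q.1‖ ^ 2 =
        (‖𝓕 (fun t => f (-t)) q.1‖ₑ ^ 2 * ‖𝓕 h q.2‖ₑ).toReal := by
    intro q
    rw [ENNReal.toReal_mul, ENNReal.toReal_pow, toReal_enorm, toReal_enorm, mul_comm]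
  simp_rw [hterm]
  rw [← ENNReal.toReal_sum (fun q _ => by finiteness)]
  apply ENNReal.toReal_mono (ENNReal.div_ne_top hTt hB0)
  rw [ENNReal.le_div_iff_mul_le (Or.inl hB0) (Or.inl hBt), Finset.sum_mul, ← hTeq]
  calc _ ≤ ∑ q ∈ s, ∫⁻ z in ball (q : EuclideanSpace ℝ (Fin d) × EuclideanSpace ℝ (Fin m)) ρ,
          A₁ z.1 * A₂ z.2 := by
        apply Finset.sum_le_sum
        intro q _
        have hvol : B = volume
            (ball (q : EuclideanSpace ℝ (Fin d) × EuclideanSpace ℝ (Fin m)) ρ) := by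
          have : (volume : Measure
              (EuclideanSpace ℝ (Fin d) × EuclideanSpace ℝ (Fin m))).IsAddHaarMeasure := by
            rw [Measure.volume_eq_prod]; infer_instance
          exact (Measure.addHaar_ball_center volume _ ρ).symm
        rw [hvol, ← setLIntegral_const]
        apply setLIntegral_mono' measurableSet_ball
        intro z hz
        rw [mem_ball, dist_eq_norm, norm_sub_rev] at hz
        have hz1 := hz.le.trans (min_le_right _ _)
        exact mul_le_mul' (hA₁ _ _ ((norm_fst_le (q.1 - z)).trans hz1))
          (hA₂ _ _ ((norm_snd_le (q.1 - z)).trans hz1))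
    _ = ∫⁻ z in ⋃ q ∈ s, ball (q : EuclideanSpace ℝ (Fin d) × EuclideanSpace ℝ (Fin m)) ρ,
          A₁ z.1 * A₂ z.2 := by
        rw [lintegral_biUnion_finset _ (fun _ _ => measurableSet_ball)]
        intro q _ q' _ hqq'
        apply ball_disjoint_ball
        by_contra! hlt
        apply hqq'
        apply Subtype.ext
        rw [← sub_eq_zero]
        apply hsep
        · intro p hp
          obtain ⟨n, hn⟩ := q.2 p hp
          obtain ⟨n', hn'⟩ := q'.2 p hp
          refine ⟨n - n', ?_⟩
          rw [Prod.fst_sub, Prod.snd_sub, inner_sub_left, inner_sub_left]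
          push_cast
          linarith
        · rw [← dist_eq_norm]
          have := min_le_left (r / 2) 1
          linarith
    _ ≤ _ := setLIntegral_le_lintegral _ _
end
end

section
/- Let 𝓛 ⊂ ℝ^d × ℝ^m be a full-rank lattice such that the projection p₁ onto ℝ^d is injective on 𝓛 and p₂(𝓛) is dense in ℝ^m, let W ⊆ ℝ^m be compact, and let Λ = {x ∈ ℝ^d : ∃ x⋆ ∈ W, (x,x⋆) ∈ 𝓛} be the associated model set (a Meyer set construction). Let c : ℝ^d → ℂ be a bounded function with support contained in Λ. Then the formal sum ω = ∑_x c(x) δ_x is translation bounded and weakly admissible: (a) for every compact K ⊆ ℝ^d, sup_{t ∈ ℝ^d} ∑_{x ∈ t+K} ‖c(x)‖ < ∞; and (b) for every continuous compactly supported f : ℝ^d → ℂ, the family (‖c(x)‖·‖𝓕⁻¹f(x)‖²)_{x ∈ ℝ^d} is summable. -/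
open MeasureTheory Metric Filter
open scoped Pointwise FourierTransform RealInnerProductSpace ENNReal Topology

noncomputable section

theorem aux_lattice {E : Type*} [NormedAddCommGroup E] [NormedSpace ℝ E] [FiniteDimensional ℝ E]
    (L : Submodule ℤ E) [DiscreteTopology L] [IsZLattice ℝ L] :
    ∃ n : ℕ, ∃ M : ℝ, ∀ w : E, ∀ F : Finset L, ∑ z ∈ F, ((1 + ‖(z : E) - w‖) ^ n)⁻¹ ≤ M := by
  classical
  have : Module.Finite ℤ L := ZLattice.module_finite ℝ L
  have : Module.Free ℤ L := ZLattice.module_free ℝ L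
  set n := Module.finrank ℤ L + 1 with hn
  have hs0 : Summable fun z : L ↦ ‖z‖⁻¹ ^ n := ZLattice.summable_norm_pow_inv L n (by omega)
  have hs : Summable fun z : L ↦ ((1 + ‖z‖) ^ n)⁻¹ := by
    refine Summable.of_norm_bounded_eventually hs0 ?_
    have : ({0} : Set L)ᶜ ∈ (cofinite : Filter L) := (Set.finite_singleton 0).compl_mem_cofinite
    filter_upwards [this] with z hz
    have hz : 0 < ‖z‖ := norm_pos_iff.2 (by simpa using hz)
    rw [Real.norm_of_nonneg (by positivity), inv_pow]
    gcongr
    linarith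
  let b0 := Module.Free.chooseBasis ℤ L
  let b := b0.ofZLatticeBasis ℝ L
  set D := ∑ i, ‖b i‖ with hD
  have hD0 : 0 ≤ D := Finset.sum_nonneg fun _ _ => norm_nonneg _
  refine ⟨n, (1 + D) ^ n * ∑' z : L, ((1 + ‖z‖) ^ n)⁻¹, fun w F => ?_⟩
  have hl : (ZSpan.floor b w : E) ∈ L := by
    have h := (ZSpan.floor b w).2
    have e : Submodule.span ℤ (Set.range b) = L := b0.ofZLatticeBasis_span ℝ
    exact e.le h
  have hlw : ‖w - (ZSpan.floor b w : E)‖ ≤ D := ZSpan.norm_fract_le b w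
  set l : L := ⟨_, hl⟩ with hldef
  have hlw : ‖w - (l : E)‖ ≤ D := hlw
  have h1 : ∀ z : L, ((1 + ‖(z : E) - w‖) ^ n)⁻¹ ≤ (1 + D) ^ n * ((1 + ‖z - l‖) ^ n)⁻¹ := by
    intro z
    rw [← div_eq_mul_inv, inv_eq_one_div, div_le_div_iff₀ (by positivity) (by positivity), one_mul,
      ← mul_pow]
    gcongr
    have : ‖z - l‖ ≤ ‖(z : E) - w‖ + ‖w - (l : E)‖ := by
      have := norm_add_le ((z : E) - w) (w - l)
      simpa using this
    nlinarith [norm_nonneg ((z : E) - w)]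
  calc _ ≤ ∑ z ∈ F, (1 + D) ^ n * ((1 + ‖z - l‖) ^ n)⁻¹ := Finset.sum_le_sum fun z _ => h1 z
    _ = (1 + D) ^ n * ∑ z ∈ F, ((1 + ‖z - l‖) ^ n)⁻¹ := by rw [Finset.mul_sum]
    _ = (1 + D) ^ n * ∑ z ∈ F.image (fun z => z - l), ((1 + ‖z‖) ^ n)⁻¹ := by
      rw [Finset.sum_image]
      intro x _ y _ h
      simpa using h
    _ ≤ _ := by
      gcongr
      exact hs.sum_le_tsum _ (fun _ _ => by positivity)

theorem aux_model {d m : ℕ}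
    (L : Submodule ℤ (EuclideanSpace ℝ (Fin d) × EuclideanSpace ℝ (Fin m)))
    [DiscreteTopology L] [IsZLattice ℝ L]
    (W : Set (EuclideanSpace ℝ (Fin m))) (hW : IsCompact W) :
    ∃ n : ℕ, ∃ M : ℝ, ∀ y : EuclideanSpace ℝ (Fin d), ∀ F : Finset (EuclideanSpace ℝ (Fin d)),
      (∀ x ∈ F, ∃ xs ∈ W, (x, xs) ∈ L) → ∑ x ∈ F, ((1 + ‖x - y‖) ^ n)⁻¹ ≤ M := by
  classical
  obtain ⟨n, M, hM⟩ := aux_lattice L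
  obtain ⟨R, hR0, hR⟩ := hW.isBounded.exists_pos_norm_le
  refine ⟨n, (1 + R) ^ n * M, fun y F hF => ?_⟩
  choose! s hsW hsL using hF
  let g : F → L := fun x => ⟨(x.1, s x.1), hsL x.1 x.2⟩
  have hg : Function.Injective g := by
    intro a b h
    have := congrArg (fun z : L => z.1.1) h
    exact Subtype.ext this
  rw [← Finset.sum_coe_sort F]
  calc _ ≤ ∑ x : F, (1 + R) ^ n * ((1 + ‖(g x).1 - (y, 0)‖) ^ n)⁻¹ := by
        refine Finset.sum_le_sum fun x _ => ?_
        rw [← div_eq_mul_inv, inv_eq_one_div, div_le_div_iff₀ (by positivity) (by positivity),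
          one_mul, ← mul_pow]
        gcongr
        have h1 : ‖(g x).1 - (y, 0)‖ ≤ ‖x.1 - y‖ + R := by
          rw [Prod.norm_def]
          refine max_le ?_ ?_
          · simp [g]; exact hR0.le
          · simp only [g, Prod.snd_sub, sub_zero]
            linarith [hR _ (hsW x.1 x.2), norm_nonneg (x.1 - y)]
        nlinarith [norm_nonneg (x.1 - y)]
    _ = (1 + R) ^ n * ∑ z ∈ Finset.univ.image g, ((1 + ‖z.1 - (y, 0)‖) ^ n)⁻¹ := by
        rw [Finset.sum_image (fun a _ b _ h => hg h), Finset.mul_sum]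
    _ ≤ _ := by
        gcongr
        exact hM _ _

theorem aux_gauss (n : ℕ) (s : ℝ) (hs : 0 ≤ s) :
    Real.exp (-Real.pi * s ^ 2) ≤ (n.factorial * Real.exp 2) * ((1 + s) ^ n)⁻¹ := by
  have h1 : (1 + s) ^ n / n.factorial ≤ Real.exp (1 + s) :=
    Real.pow_div_factorial_le_exp _ (by linarith) n
  have hf : (0 : ℝ) < n.factorial := by positivity
  rw [div_le_iff₀ hf] at h1
  rw [← div_eq_mul_inv, le_div_iff₀ (by positivity)]
  calc _ ≤ Real.exp (-Real.pi * s ^ 2) * (Real.exp (1 + s) * n.factorial) := by gcongr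
    _ = n.factorial * Real.exp (-Real.pi * s ^ 2 + (1 + s)) := by
      rw [Real.exp_add (-Real.pi * s ^ 2) (1 + s)]; ring
    _ ≤ _ := by
      gcongr
      nlinarith [Real.pi_gt_three, sq_nonneg (s - 1 / 2), sq_nonneg s]

/-- The exponential character. -/
def auxE {d : ℕ} (x t : EuclideanSpace ℝ (Fin d)) : ℂ :=
  Complex.exp ((2 * Real.pi * Complex.I) * ((inner ℝ x t : ℝ) : ℂ))

theorem auxE_norm {d : ℕ} (x t : EuclideanSpace ℝ (Fin d)) : ‖auxE x t‖ = 1 := by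
  have : auxE x t = Complex.exp (((2 * Real.pi * (inner ℝ x t : ℝ) : ℝ) : ℂ) * Complex.I) := by
    rw [auxE]; congr 1; push_cast; ring
  rw [this, Complex.norm_exp_ofReal_mul_I]

theorem auxE_cont {d : ℕ} (x : EuclideanSpace ℝ (Fin d)) : Continuous (auxE x) := by
  unfold auxE; fun_prop

theorem auxE_conj {d : ℕ} (x t : EuclideanSpace ℝ (Fin d)) :
    (starRingEnd ℂ) (auxE x t) = Complex.exp (-(2 * Real.pi * Complex.I) * ((inner ℝ x t : ℝ) : ℂ)) := by
  rw [auxE, ← Complex.exp_conj]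
  have h2 : (starRingEnd ℂ) 2 = 2 := Complex.conj_ofNat 2
  simp [h2]

theorem auxE_inv {d : ℕ} (f : EuclideanSpace ℝ (Fin d) → ℂ) (x : EuclideanSpace ℝ (Fin d)) :
    𝓕⁻ f x = ∫ t, auxE x t * f t := by
  rw [Real.fourierInv_eq']
  congr 1; ext t
  rw [smul_eq_mul, auxE, real_inner_comm]
  congr 2; push_cast; ring

theorem aux_quad {d : ℕ} (F : Finset (EuclideanSpace ℝ (Fin d)))
    (a : EuclideanSpace ℝ (Fin d) → ℂ) (M : ℝ)
    (hM : ∀ y, ∑ x ∈ F, Real.exp (-Real.pi * ‖x - y‖ ^ 2) ≤ M) :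
    Integrable (fun t : EuclideanSpace ℝ (Fin d) =>
      Real.exp (-Real.pi * ‖t‖ ^ 2) * ‖∑ x ∈ F, a x * auxE x t‖ ^ 2) ∧
    ∫ t : EuclideanSpace ℝ (Fin d),
      Real.exp (-Real.pi * ‖t‖ ^ 2) * ‖∑ x ∈ F, a x * auxE x t‖ ^ 2 ≤ M * ∑ x ∈ F, ‖a x‖ ^ 2 := by
  have hpi : 0 < ((Real.pi : ℂ)).re := by simpa using Real.pi_pos
  let G : EuclideanSpace ℝ (Fin d) → EuclideanSpace ℝ (Fin d) → ℂ := fun w t =>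
    Complex.exp (-(Real.pi : ℂ) * ‖t‖ ^ 2 + (2 * Real.pi * Complex.I) * ((inner ℝ w t : ℝ) : ℂ))
  have hGi : ∀ w, Integrable (G w) := fun w =>
    GaussianFourier.integrable_cexp_neg_mul_sq_norm_add hpi (2 * Real.pi * Complex.I) w
  have hGv : ∀ w, ∫ t, G w t = ((Real.exp (-Real.pi * ‖w‖ ^ 2) : ℝ) : ℂ) := by
    intro w
    rw [show (∫ t, G w t) = _ from
      GaussianFourier.integral_cexp_neg_mul_sq_norm_add hpi (2 * Real.pi * Complex.I) w]
    have hp : (Real.pi : ℂ) ≠ 0 := by exact_mod_cast Real.pi_ne_zero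
    rw [div_self hp, Complex.one_cpow, one_mul]
    push_cast
    congr 1
    field_simp
    rw [Complex.I_sq]; ring
  have hpt : ∀ t : EuclideanSpace ℝ (Fin d),
      ((Real.exp (-Real.pi * ‖t‖ ^ 2) * ‖∑ x ∈ F, a x * auxE x t‖ ^ 2 : ℝ) : ℂ) =
      ∑ x ∈ F, ∑ y ∈ F, (a x * (starRingEnd ℂ) (a y)) * G (x - y) t := by
    intro t
    push_cast
    rw [← Complex.mul_conj', map_sum, Finset.sum_mul_sum, Finset.mul_sum]
    refine Finset.sum_congr rfl fun x _ => ?_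
    rw [Finset.mul_sum]
    refine Finset.sum_congr rfl fun y _ => ?_
    rw [map_mul, auxE_conj]
    have : G (x - y) t = Complex.exp (-(Real.pi : ℂ) * ‖t‖ ^ 2) * (auxE x t *
        Complex.exp (-(2 * Real.pi * Complex.I) * ((inner ℝ y t : ℝ) : ℂ))) := by
      simp only [G, auxE]
      rw [← Complex.exp_add, ← Complex.exp_add]
      congr 1
      rw [inner_sub_left]; push_cast; ring
    rw [this]; ring
  have hint : Integrable (fun t : EuclideanSpace ℝ (Fin d) =>
      ∑ x ∈ F, ∑ y ∈ F, (a x * (starRingEnd ℂ) (a y)) * G (x - y) t) :=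
    integrable_finsetSum _ fun x _ => integrable_finsetSum _ fun y _ => (hGi _).const_mul _
  have hint' : Integrable (fun t : EuclideanSpace ℝ (Fin d) =>
      Real.exp (-Real.pi * ‖t‖ ^ 2) * ‖∑ x ∈ F, a x * auxE x t‖ ^ 2) := by
    have h := hint.re
    refine h.congr (Filter.Eventually.of_forall fun t => ?_)
    simp only [← hpt t]
    exact Complex.ofReal_re _
  refine ⟨hint', ?_⟩
  have hval : ((∫ t : EuclideanSpace ℝ (Fin d),
      Real.exp (-Real.pi * ‖t‖ ^ 2) * ‖∑ x ∈ F, a x * auxE x t‖ ^ 2 : ℝ) : ℂ) =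
      ∑ x ∈ F, ∑ y ∈ F, (a x * (starRingEnd ℂ) (a y)) *
        ((Real.exp (-Real.pi * ‖x - y‖ ^ 2) : ℝ) : ℂ) := by
    rw [← integral_complex_ofReal]
    simp_rw [hpt]
    rw [integral_finsetSum _ fun x _ => integrable_finsetSum _ fun y _ => (hGi _).const_mul _]
    refine Finset.sum_congr rfl fun x _ => ?_
    rw [integral_finsetSum _ fun y _ => (hGi _).const_mul _]
    refine Finset.sum_congr rfl fun y _ => ?_
    rw [integral_const_mul, hGv]
  have hb := congrArg norm hval
  rw [Complex.norm_real] at hb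
  refine (Real.le_norm_self _).trans (hb.le.trans ?_)
  calc _ ≤ ∑ x ∈ F, ∑ y ∈ F, ((‖a x‖ ^ 2 / 2) * Real.exp (-Real.pi * ‖x - y‖ ^ 2) +
          (‖a y‖ ^ 2 / 2) * Real.exp (-Real.pi * ‖x - y‖ ^ 2)) := by
        refine norm_sum_le_of_le _ fun x _ => norm_sum_le_of_le _ fun y _ => ?_
        rw [norm_mul, norm_mul, RCLike.norm_conj, Complex.norm_real,
          Real.norm_of_nonneg (Real.exp_nonneg _), ← add_mul]
        gcongr
        nlinarith [sq_nonneg (‖a x‖ - ‖a y‖)]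
    _ = ∑ x ∈ F, (‖a x‖ ^ 2 / 2) * ∑ y ∈ F, Real.exp (-Real.pi * ‖y - x‖ ^ 2) +
        ∑ y ∈ F, (‖a y‖ ^ 2 / 2) * ∑ x ∈ F, Real.exp (-Real.pi * ‖x - y‖ ^ 2) := by
        simp_rw [Finset.sum_add_distrib]
        congr 1
        · simp_rw [Finset.mul_sum, norm_sub_rev]
        · rw [Finset.sum_comm]
          simp_rw [Finset.mul_sum]
    _ ≤ ∑ x ∈ F, (‖a x‖ ^ 2 / 2) * M + ∑ y ∈ F, (‖a y‖ ^ 2 / 2) * M := by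
        gcongr
        · exact hM _
        · exact hM _
    _ = _ := by
        rw [← Finset.sum_add_distrib, Finset.mul_sum]
        exact Finset.sum_congr rfl fun _ _ => by ring

theorem aux_sieve {d : ℕ} (M : ℝ) (hM0 : 0 < M) (f : EuclideanSpace ℝ (Fin d) → ℂ)
    (hf : Continuous f) (hfc : HasCompactSupport f) :
    ∃ B : ℝ, ∀ F : Finset (EuclideanSpace ℝ (Fin d)),
      (∀ y, ∑ x ∈ F, Real.exp (-Real.pi * ‖x - y‖ ^ 2) ≤ M) →
      ∑ x ∈ F, ‖𝓕⁻ f x‖ ^ 2 ≤ B := by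
  obtain ⟨R, hR0, hR⟩ := hfc.isBounded.exists_pos_norm_le
  set A := Real.exp (Real.pi * R ^ 2) with hA
  have hA0 : 0 < A := Real.exp_pos _
  set lam := A * M with hlam
  have hlam0 : 0 < lam := by positivity
  clear_value A lam
  refine ⟨lam * ∫ t, ‖f t‖ ^ 2, fun F hM => ?_⟩
  set a : EuclideanSpace ℝ (Fin d) → ℂ := fun x => (starRingEnd ℂ) (𝓕⁻ f x) with ha
  set S := ∑ x ∈ F, ‖𝓕⁻ f x‖ ^ 2 with hS
  have hS' : ∑ x ∈ F, ‖a x‖ ^ 2 = S := by simp [a, hS]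
  obtain ⟨hqi, hq⟩ := aux_quad F a M hM
  rw [hS'] at hq
  have hfi : ∀ x, Integrable (fun t => auxE x t * f t) := fun x =>
    ((auxE_cont x).mul hf).integrable_of_hasCompactSupport hfc.mul_left
  have hf2 : Integrable (fun t => ‖f t‖ ^ 2) := by
    refine (hf.norm.pow 2).integrable_of_hasCompactSupport ?_
    have h := hfc.comp_left (g := fun z : ℂ => ‖z‖ ^ 2) (by simp)
    exact h
  have hSeq : (S : ℂ) = ∫ t, (∑ x ∈ F, a x * auxE x t) * f t := by
    simp_rw [Finset.sum_mul, mul_assoc]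
    rw [integral_finsetSum _ fun x _ => (hfi x).const_mul _, hS]
    push_cast
    refine Finset.sum_congr rfl fun x _ => ?_
    rw [integral_const_mul, ← auxE_inv, ← Complex.conj_mul']
  have hb := congrArg norm hSeq
  rw [Complex.norm_real] at hb
  have h1 : S ≤ ∫ t, (lam / 2 * ‖f t‖ ^ 2 + A / (2 * lam) *
      (Real.exp (-Real.pi * ‖t‖ ^ 2) * ‖∑ x ∈ F, a x * auxE x t‖ ^ 2)) := by
    refine (Real.le_norm_self _).trans (hb.le.trans ?_)
    refine norm_integral_le_of_norm_le ((hf2.const_mul _).add (hqi.const_mul _))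
      (Filter.Eventually.of_forall fun t => ?_)
    rw [norm_mul]
    set p := ‖∑ x ∈ F, a x * auxE x t‖ with hp
    by_cases h0 : f t = 0
    · rw [h0]; simp; positivity
    · have htR : ‖t‖ ≤ R := hR t (subset_tsupport f h0)
      have hg : 1 ≤ A * Real.exp (-Real.pi * ‖t‖ ^ 2) := by
        rw [hA, ← Real.exp_add]
        apply Real.one_le_exp
        have : ‖t‖ ^ 2 ≤ R ^ 2 := by gcongr
        nlinarith [Real.pi_pos]
      have h2 : p * ‖f t‖ ≤ lam / 2 * ‖f t‖ ^ 2 + 1 / (2 * lam) * p ^ 2 := by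
        have h3 : lam / 2 * ‖f t‖ ^ 2 + 1 / (2 * lam) * p ^ 2 - p * ‖f t‖ =
          (lam * ‖f t‖ - p) ^ 2 / (2 * lam) := by field_simp; ring
        have : 0 ≤ (lam * ‖f t‖ - p) ^ 2 / (2 * lam) := by positivity
        linarith
      refine h2.trans ?_
      have : 1 / (2 * lam) * p ^ 2 * 1 ≤
          1 / (2 * lam) * p ^ 2 * (A * Real.exp (-Real.pi * ‖t‖ ^ 2)) := by gcongr
      have e : A / (2 * lam) * (Real.exp (-Real.pi * ‖t‖ ^ 2) * p ^ 2) =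
        1 / (2 * lam) * p ^ 2 * (A * Real.exp (-Real.pi * ‖t‖ ^ 2)) := by ring
      rw [e]; linarith
  rw [integral_add (hf2.const_mul _) (hqi.const_mul _), integral_const_mul,
    integral_const_mul] at h1
  have h4 : A / (2 * lam) * (∫ t : EuclideanSpace ℝ (Fin d),
      Real.exp (-Real.pi * ‖t‖ ^ 2) * ‖∑ x ∈ F, a x * auxE x t‖ ^ 2) ≤ A / (2 * lam) * (M * S) := by
    gcongr
  have h5 : A / (2 * lam) * (M * S) = S / 2 := by rw [hlam]; field_simp
  linarith

/-- Let a Euclidean cut-and-project scheme be given by a full-rank lattice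
`L ⊂ ℝ^d × ℝ^m`, let `W ⊆ ℝ^m` be a compact window and `Λ = {x : ∃ x⋆ ∈ W, (x,x⋆) ∈ L}` the
associated model set. If `c : ℝ^d → ℂ` is bounded with support in `Λ`, then the formal sum
`∑_x c(x) δ_x` is translation bounded (a) and weakly admissible (b). -/
theorem fourierTransformable_sap_stmt14 {d m : ℕ}
    (L : Submodule ℤ (EuclideanSpace ℝ (Fin d) × EuclideanSpace ℝ (Fin m)))
    [DiscreteTopology L] [IsZLattice ℝ L]
    (hinj : ∀ p q : L, (p : EuclideanSpace ℝ (Fin d) × EuclideanSpace ℝ (Fin m)).1 =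
      (q : EuclideanSpace ℝ (Fin d) × EuclideanSpace ℝ (Fin m)).1 → p = q)
    (hdense : Dense (Prod.snd '' (L : Set (EuclideanSpace ℝ (Fin d) × EuclideanSpace ℝ (Fin m)))))
    (W : Set (EuclideanSpace ℝ (Fin m))) (hW : IsCompact W)
    (c : EuclideanSpace ℝ (Fin d) → ℂ)
    (hcbdd : ∃ C : ℝ, ∀ x, ‖c x‖ ≤ C)
    (hsupp : Function.support c ⊆
      {x : EuclideanSpace ℝ (Fin d) | ∃ xs ∈ W, (x, xs) ∈ L}) :
    -- (a) translation boundedness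
    (∀ K : Set (EuclideanSpace ℝ (Fin d)), IsCompact K →
      (⨆ t : EuclideanSpace ℝ (Fin d),
        ∑' x : (t +ᵥ K : Set (EuclideanSpace ℝ (Fin d))), (‖c x‖₊ : ℝ≥0∞)) < ⊤) ∧
    -- (b) weak admissibility
    (∀ f : EuclideanSpace ℝ (Fin d) → ℂ, Continuous f → HasCompactSupport f →
      Summable fun x : EuclideanSpace ℝ (Fin d) => ‖c x‖ * ‖𝓕⁻ f x‖ ^ 2) := by
  classical
  obtain ⟨C0, hC0⟩ := hcbdd
  obtain ⟨C, hC, hCpos⟩ : ∃ C : ℝ, (∀ x, ‖c x‖ ≤ C) ∧ 0 < C :=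
    ⟨max C0 1, fun x => (hC0 x).trans (le_max_left _ _), by positivity⟩
  obtain ⟨n, M, hM⟩ := aux_model L W hW
  have hM0 : 0 ≤ M := by simpa using hM 0 ∅ (by simp)
  constructor
  · intro K hK
    obtain ⟨R, hR0, hR⟩ := hK.isBounded.exists_pos_norm_le
    refine lt_of_le_of_lt (iSup_le fun t => ?_)
      (ENNReal.ofReal_lt_top (r := C * (1 + R) ^ n * M))
    rw [ENNReal.tsum_eq_iSup_sum]
    refine iSup_le fun s => ?_
    have hsum : ∑ x ∈ s, (‖c x‖₊ : ℝ≥0∞) = ENNReal.ofReal (∑ x ∈ s, ‖c x‖) := by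
      rw [ENNReal.ofReal_sum_of_nonneg fun _ _ => norm_nonneg _]
      refine Finset.sum_congr rfl fun x _ => ?_
      rw [ofReal_norm]; rfl
    rw [hsum]
    apply ENNReal.ofReal_le_ofReal
    set F := (s.image Subtype.val).filter (fun x => c x ≠ 0) with hF
    have h1 : ∑ x ∈ s, ‖c x‖ = ∑ x ∈ F, ‖c x‖ := by
      rw [hF, Finset.sum_filter_of_ne, Finset.sum_image]
      · intro a _ b _ h; exact Subtype.ext h
      · intro x _ h; simpa using h
    rw [h1]
    have hFK : ∀ x ∈ F, ‖x - t‖ ≤ R := by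
      intro x hx
      simp only [hF, Finset.mem_filter, Finset.mem_image] at hx
      obtain ⟨⟨z, _, rfl⟩, _⟩ := hx
      obtain ⟨k, hk, hkz⟩ := z.2
      have : z.1 - t = k := by rw [← hkz]; simp [vadd_eq_add]
      rw [this]; exact hR k hk
    have hFL : ∀ x ∈ F, ∃ xs ∈ W, (x, xs) ∈ L := by
      intro x hx
      exact hsupp (Finset.mem_filter.1 hx).2
    calc _ ≤ ∑ x ∈ F, C * (1 + R) ^ n * ((1 + ‖x - t‖) ^ n)⁻¹ := by
          refine Finset.sum_le_sum fun x hx => (hC x).trans ?_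
          rw [← div_eq_mul_inv, le_div_iff₀ (by positivity)]
          have := hFK x hx
          gcongr
      _ = C * (1 + R) ^ n * ∑ x ∈ F, ((1 + ‖x - t‖) ^ n)⁻¹ := by rw [Finset.mul_sum]
      _ ≤ _ := by
          gcongr
          exact hM t F hFL
  · intro f hf hfc
    obtain ⟨B, hB⟩ := aux_sieve ((n.factorial * Real.exp 2) * M + 1) (by positivity) f hf hfc
    refine summable_of_sum_le (c := C * B) (fun _ => by positivity) fun s => ?_
    set F := s.filter (fun x => c x ≠ 0) with hF
    have hFL : ∀ x ∈ F, ∃ xs ∈ W, (x, xs) ∈ L := by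
      intro x hx
      exact hsupp (Finset.mem_filter.1 hx).2
    have h1 : ∑ x ∈ s, ‖c x‖ * ‖𝓕⁻ f x‖ ^ 2 = ∑ x ∈ F, ‖c x‖ * ‖𝓕⁻ f x‖ ^ 2 := by
      rw [hF, Finset.sum_filter_of_ne]
      intro x _ h h0
      simp [h0] at h
    rw [h1]
    calc _ ≤ ∑ x ∈ F, C * ‖𝓕⁻ f x‖ ^ 2 := by
          gcongr with x hx
          exact hC x
      _ = C * ∑ x ∈ F, ‖𝓕⁻ f x‖ ^ 2 := by rw [Finset.mul_sum]
      _ ≤ _ := by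
          gcongr
          apply hB F
          intro y
          calc _ ≤ ∑ x ∈ F, (n.factorial * Real.exp 2) * ((1 + ‖x - y‖) ^ n)⁻¹ :=
                Finset.sum_le_sum fun x _ => aux_gauss n _ (norm_nonneg _)
            _ = (n.factorial * Real.exp 2) * ∑ x ∈ F, ((1 + ‖x - y‖) ^ n)⁻¹ := by
                rw [Finset.mul_sum]
            _ ≤ (n.factorial * Real.exp 2) * M := by
                gcongr
                exact hM y F hFL
            _ ≤ _ := by linarith
end
end
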